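/- Let λ be a nonzero real number, let k ≥ 1 be an integer, and let x be a real number with |x| < 1. Then the series Σ_{n=1}^∞ H_{n,λ} · (n)_{k,λ} · x^n converges absolutely and equals (1/(1−x)) · HF_{k,λ}(x/(1−x)) − (log_λ(1−x)/(1−x)) · F^{(1−λ)}_{k,λ}(x/(1−x)), where log_λ(1−x) = ((1−x)^λ − 1)/λ. -/

import Mathlib

open Finset

/-- The degenerate falling factorial `(x)_{n,λ} = x(x-λ)⋯(x-(n-1)λ)`. -/
noncomputable def degFall (lam x : ℝ) (n : ℕ) : ℝ := ∏ i ∈ Finset.range n, (x - (i : ℝ) * lam)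

/-- The ordinary falling factorial `(x)_n = x(x-1)⋯(x-n+1)`. -/
noncomputable def fall (x : ℝ) (n : ℕ) : ℝ := ∏ i ∈ Finset.range n, (x - (i : ℝ))

/-- The rising factorial `⟨a⟩_k = a(a+1)⋯(a+k-1)`. -/
noncomputable def rising (a : ℝ) (k : ℕ) : ℝ := ∏ i ∈ Finset.range k, (a + (i : ℝ))

/-- The generalized binomial coefficient `binom(a,k) = a(a-1)⋯(a-k+1)/k!`. -/
noncomputable def rchoose (a : ℝ) (k : ℕ) : ℝ :=
  (∏ i ∈ Finset.range k, (a - (i : ℝ))) / (k.factorial : ℝ)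

/-- The degenerate harmonic numbers `H_{n,λ} = Σ_{k=1}^n (1/k)·binom(k-1-λ, k-1)`. -/
noncomputable def degH (lam : ℝ) (n : ℕ) : ℝ :=
  ∑ k ∈ Finset.Icc 1 n, (1 / (k : ℝ)) * rchoose ((k : ℝ) - 1 - lam) (k - 1)

/-- The degenerate hyperharmonic numbers `H^{(r)}_{n,λ}`. -/
noncomputable def degHyperH (lam : ℝ) : ℕ → ℕ → ℝ
  | 0, _ => 0
  | 1, n => degH lam n
  | r + 2, n => ∑ k ∈ Finset.Icc 1 n, degHyperH lam (r + 1) k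

/-- The degenerate harmonic-Fubini polynomial built from degenerate Stirling numbers `S2`. -/
noncomputable def HFpoly (lam : ℝ) (S2 : ℕ → ℕ → ℝ) (n : ℕ) (x : ℝ) : ℝ :=
  ∑ k ∈ Finset.Icc 1 n, S2 n k * degH lam k * (k.factorial : ℝ) * x ^ k

/-- The degenerate Fubini polynomial of order `1-λ` built from degenerate Stirling numbers `S2`. -/
noncomputable def Fpoly (lam : ℝ) (S2 : ℕ → ℕ → ℝ) (n : ℕ) (x : ℝ) : ℝ :=
  ∑ k ∈ Finset.range (n + 1), rising (1 - lam) k * S2 n k * x ^ k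

/-- The degenerate hyperharmonic-Fubini polynomial built from degenerate Stirling numbers `S2`. -/
noncomputable def HFpolyR (lam : ℝ) (S2 : ℕ → ℕ → ℝ) (r n : ℕ) (y : ℝ) : ℝ :=
  ∑ k ∈ Finset.Icc 1 n, S2 n k * degHyperH lam r k * (k.factorial : ℝ) * y ^ k

/-- The degenerate falling factorial power of the operator `θ = x·d/dx`:
`(θ)_{k,λ} = (θ - (k-1)λ) ∘ ⋯ ∘ (θ - λ) ∘ θ`. -/
noncomputable def thetaFall (lam : ℝ) : ℕ → (ℝ → ℝ) → ℝ → ℝ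
  | 0, g => g
  | k + 1, g => fun x => x * deriv (thetaFall lam k g) x - (k : ℝ) * lam * thetaFall lam k g x

theorem fall_succ (z : ℝ) (n : ℕ) : fall z (n + 1) = fall z n * (z - n) := by
  simp [fall, Finset.prod_range_succ]

theorem fall_add_one_succ (z : ℝ) (n : ℕ) : fall (z + 1) (n + 1) = (z + 1) * fall z n := by
  simp [fall, Finset.prod_range_succ', mul_comm]

theorem fall_natCast_eq_zero {n j : ℕ} (h : n < j) : fall (n : ℝ) j = 0 :=
  Finset.prod_eq_zero (Finset.mem_range.2 h) (sub_self _)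

theorem fall_add_mul_factorial (m j : ℕ) :
    fall ((m + j : ℕ) : ℝ) j * (m.factorial : ℝ) = ((m + j).factorial : ℝ) := by
  induction j with
  | zero => simp [fall]
  | succ j ih =>
    rw [← add_assoc, Nat.cast_add_one, fall_add_one_succ, mul_assoc, ih, Nat.factorial_succ]
    push_cast
    ring

theorem rising_succ (a : ℝ) (n : ℕ) : rising a (n + 1) = rising a n * (a + n) := by
  simp [rising, Finset.prod_range_succ]

theorem rising_succ' (a : ℝ) (n : ℕ) : rising a (n + 1) = a * rising (a + 1) n := by
  rw [rising, Finset.prod_range_succ', mul_comm, rising]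
  congr 1
  · simp
  · refine Finset.prod_congr rfl fun i _ => ?_
    push_cast
    ring

theorem rising_add (a : ℝ) (m j : ℕ) : rising a (m + j) = rising a j * rising (a + j) m := by
  rw [add_comm m j, rising, Finset.prod_range_add, rising, rising]
  congr 1
  refine Finset.prod_congr rfl fun i _ => ?_
  push_cast
  ring

theorem rising_eq_ascPochhammer_eval (a : ℝ) (n : ℕ) :
    rising a n = (ascPochhammer ℝ n).eval a := by
  induction n with
  | zero => simp [rising]
  | succ n ih => rw [rising_succ, ih, ascPochhammer_succ_eval]

theorem choose_add_sub_one_eq_rising_div (a : ℝ) (n : ℕ) :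
    Ring.choose (a + n - 1) n = rising a n / (n.factorial : ℝ) := by
  have h := Ring.factorial_nsmul_multichoose_eq_ascPochhammer a n
  rw [Polynomial.ascPochhammer_smeval_eq_eval, ← rising_eq_ascPochhammer_eval, nsmul_eq_mul,
    Ring.multichoose_eq] at h
  rw [← h, mul_div_cancel_left₀ _ (Nat.cast_ne_zero.2 n.factorial_ne_zero)]

/-- The binomial series for `(1 - x) ^ (-a)`. -/
theorem hasSum_rising_div_factorial_mul_pow (a : ℝ) {x : ℝ} (hx : |x| < 1) :
    HasSum (fun n : ℕ => rising a n / (n.factorial : ℝ) * x ^ n) (1 / (1 - x) ^ a) := by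
  have h := (Real.one_div_one_sub_rpow_hasFPowerSeriesOnBall_zero a).hasSum (y := x)
    (by
      rw [Metric.mem_eball, edist_zero_right, ← ofReal_norm, Real.norm_eq_abs]
      exact ENNReal.ofReal_lt_one.2 hx)
  simp only [zero_add] at h
  convert! h using 2 with n
  rw [FormalMultilinearSeries.ofScalars_apply_eq, choose_add_sub_one_eq_rising_div, smul_eq_mul]

theorem rchoose_natCast_sub (lam : ℝ) (n : ℕ) :
    rchoose ((n : ℝ) - lam) n = rising (1 - lam) n / (n.factorial : ℝ) := by
  rw [rchoose, rising, ← Finset.prod_range_reflect]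
  congr 1
  refine Finset.prod_congr rfl fun i hi => ?_
  have : i + 1 ≤ n := Finset.mem_range.1 hi
  rw [Nat.sub_sub, add_comm 1 i, Nat.cast_sub this]
  push_cast
  ring

theorem degH_zero (lam : ℝ) : degH lam 0 = 0 := by simp [degH]

theorem degH_succ (lam : ℝ) (n : ℕ) :
    degH lam (n + 1) = degH lam n + rising (1 - lam) n / ((n + 1).factorial : ℝ) := by
  rw [degH, Finset.sum_Icc_succ_top (by omega), ← degH]
  have h : ((n + 1 : ℕ) : ℝ) - 1 - lam = n - lam := by push_cast; ring
  rw [h, Nat.add_sub_cancel, rchoose_natCast_sub, Nat.factorial_succ]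
  push_cast
  field_simp

/-- Summation by parts against the geometric series: the generating function of a sequence is
that of its differences divided by `1 - x`. -/
theorem hasSum_mul_pow_of_hasSum_sub {f : ℕ → ℝ} (h0 : f 0 = 0) {x S : ℝ} (hx : |x| < 1)
    (h : HasSum (fun n => (f (n + 1) - f n) * x ^ (n + 1)) S) :
    HasSum (fun n => f n * x ^ n) (S / (1 - x)) := by
  have hg : Summable fun n : ℕ => ‖x ^ n‖ := summable_norm_geometric_of_norm_lt_one hx
  have hp := hasSum_sum_range_mul_of_summable_norm h.summable.norm hg
  rw [h.tsum_eq, tsum_geometric_of_norm_lt_one hx, ← div_eq_mul_inv] at hp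
  rw [← hasSum_nat_add_iff' 1]
  simp only [Finset.sum_range_one, h0, zero_mul, sub_zero]
  convert! hp using 2 with n
  have : ∀ i ∈ Finset.range (n + 1),
      (f (i + 1) - f i) * x ^ (i + 1) * x ^ (n - i) = (f (i + 1) - f i) * x ^ (n + 1) := by
    intro i hi
    have : i + 1 + (n - i) = n + 1 := by have := Finset.mem_range.1 hi; omega
    rw [mul_assoc, ← pow_add, this]
  rw [Finset.sum_congr rfl this, ← Finset.sum_mul, Finset.sum_range_sub, h0, sub_zero]

theorem hasSum_degH_mul_pow {lam x : ℝ} (hlam : lam ≠ 0) (hx : |x| < 1) :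
    HasSum (fun n : ℕ => degH lam n * x ^ n) (-(((1 - x) ^ lam - 1) / lam) / (1 - x)) := by
  refine hasSum_mul_pow_of_hasSum_sub (degH_zero lam) hx ?_
  have h := hasSum_rising_div_factorial_mul_pow (-lam) hx
  rw [← hasSum_nat_add_iff' 1] at h
  have hpos : 0 < 1 - x := by linarith [(abs_lt.1 hx).2]
  convert! h.mul_left (-1 / lam) using 1
  · funext n
    rw [degH_succ, rising_succ', neg_add_eq_sub]
    field_simp
    ring
  · rw [Real.rpow_neg hpos.le]
    simp [rising]
    ring

theorem hasSum_rising_div_factorial_mul_fall_mul_pow (a : ℝ) (j : ℕ) {x : ℝ} (hx : |x| < 1) :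
    HasSum (fun n : ℕ => rising a n / (n.factorial : ℝ) * fall n j * x ^ n)
      (x ^ j * rising a j / (1 - x) ^ (a + j)) := by
  rw [← hasSum_nat_add_iff' j, Finset.sum_eq_zero, sub_zero]
  · convert! (hasSum_rising_div_factorial_mul_pow (a + j) hx).mul_left (x ^ j * rising a j) using 1
    · funext m
      rw [rising_add, ← fall_add_mul_factorial m j, pow_add]
      have h1 : fall ((m + j : ℕ) : ℝ) j ≠ 0 := by
        intro h
        have := fall_add_mul_factorial m j
        rw [h, zero_mul] at this
        exact Nat.cast_ne_zero.2 (m + j).factorial_ne_zero this.symm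
      have h2 : (m.factorial : ℝ) ≠ 0 := Nat.cast_ne_zero.2 m.factorial_ne_zero
      field_simp
    · ring
  · intro n hn
    rw [fall_natCast_eq_zero (Finset.mem_range.1 hn)]
    ring

theorem hasSum_degH_mul_fall_mul_pow {lam x : ℝ} (hlam : lam ≠ 0) (hx : |x| < 1) (j : ℕ) :
    HasSum (fun n : ℕ => degH lam n * fall n j * x ^ n)
      (x ^ j / (1 - x) ^ (j + 1) *
        (j.factorial * degH lam j - rising (1 - lam) j * (((1 - x) ^ lam - 1) / lam))) := by
  have hpos : 0 < 1 - x := by linarith [(abs_lt.1 hx).2]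
  induction j with
  | zero =>
    convert! hasSum_degH_mul_pow hlam hx using 1
    · simp [fall]
    · simp [rising, degH_zero]
      ring
  | succ j ih =>
    have hb := hasSum_rising_div_factorial_mul_fall_mul_pow (1 - lam) j hx
    have hs := ((ih.mul_left ((j : ℝ) + 1)).add hb).mul_left x
    have hd : ∀ n : ℕ, x * (((j : ℝ) + 1) * (degH lam n * fall n j * x ^ n)
          + rising (1 - lam) n / (n.factorial : ℝ) * fall n j * x ^ n)
        = (degH lam (n + 1) * fall ((n + 1 : ℕ) : ℝ) (j + 1) - degH lam n * fall n (j + 1))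
          * x ^ (n + 1) := by
      intro n
      rw [degH_succ, Nat.cast_add_one, fall_add_one_succ, fall_succ, Nat.factorial_succ]
      have hf : (n.factorial : ℝ) ≠ 0 := Nat.cast_ne_zero.2 n.factorial_ne_zero
      have hn : (n : ℝ) + 1 ≠ 0 := Nat.cast_add_one_ne_zero n
      push_cast
      field_simp
      ring
    simp only [hd] at hs
    convert! hasSum_mul_pow_of_hasSum_sub (f := fun n : ℕ => degH lam n * fall n (j + 1))
      (by simp [degH_zero]) hx hs using 1
    have hr : (1 - x) ^ (1 - lam + j) = (1 - x) ^ (j + 1) / (1 - x) ^ lam := by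
      rw [← Real.rpow_natCast, ← Real.rpow_sub hpos]
      congr 1
      push_cast
      ring
    have hP : (1 - x) ^ lam ≠ 0 := (Real.rpow_pos_of_pos hpos lam).ne'
    rw [hr, degH_succ, rising_succ, Nat.factorial_succ]
    have hf : (j.factorial : ℝ) ≠ 0 := Nat.cast_ne_zero.2 j.factorial_ne_zero
    have := hpos.ne'
    push_cast
    field_simp
    ring

theorem stmt9 (lam : ℝ) (hlam : lam ≠ 0) (k : ℕ) (hk : 1 ≤ k) (x : ℝ) (hx : |x| < 1)
    (S2 : ℕ → ℕ → ℝ)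
    (hS2 : ∀ (m : ℕ) (z : ℝ), degFall lam z m = ∑ j ∈ Finset.range (m + 1), S2 m j * fall z j) :
    Summable (fun n : ℕ => |degH lam n * degFall lam (n : ℝ) k * x ^ n|) ∧
    ∑' n : ℕ, degH lam n * degFall lam (n : ℝ) k * x ^ n
      = (1 / (1 - x)) * HFpoly lam S2 k (x / (1 - x))
        - (((1 - x) ^ lam - 1) / lam / (1 - x)) * Fpoly lam S2 k (x / (1 - x)) := by
  have hpos : 0 < 1 - x := by linarith [(abs_lt.1 hx).2]
  have h : HasSum (fun n : ℕ => degH lam n * degFall lam (n : ℝ) k * x ^ n)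
      ((1 / (1 - x)) * HFpoly lam S2 k (x / (1 - x))
        - (((1 - x) ^ lam - 1) / lam / (1 - x)) * Fpoly lam S2 k (x / (1 - x))) := by
    convert! hasSum_sum fun j (_ : j ∈ Finset.range (k + 1)) =>
      (hasSum_degH_mul_fall_mul_pow hlam hx j).mul_left (S2 k j) using 1
    · funext n
      rw [hS2, Finset.mul_sum, Finset.sum_mul]
      exact Finset.sum_congr rfl fun j _ => by ring
    · have hHF : HFpoly lam S2 k (x / (1 - x)) = ∑ j ∈ Finset.range (k + 1),
          S2 k j * degH lam j * (j.factorial : ℝ) * (x / (1 - x)) ^ j := by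
        rw [HFpoly, Finset.range_eq_Ico, Finset.sum_eq_sum_Ico_succ_bot (by omega), degH_zero]
        simp only [mul_zero, zero_mul, zero_add]
        rfl
      rw [hHF, Fpoly, Finset.mul_sum, Finset.mul_sum, ← Finset.sum_sub_distrib]
      refine Finset.sum_congr rfl fun j _ => ?_
      have := hpos.ne'
      rw [div_pow, pow_succ]
      field_simp
  exact ⟨h.summable.abs, h.tsum_eq⟩
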